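/- Let α > 0, let Q = (Q_i)_{i∈ℤ^d} be a random element of l₀ with ‖Q‖ = 1 a.s. and E[Σ_{k∈ℤ^d} |Q_k|^α] < ∞, let V be Pareto(α)-distributed and independent of Q, and set Z := V·Q. Then E[|e(Z)|] = E[Σ_{k∈ℤ^d}|Q_k|^α] < ∞, and the random element Y of E₀ whose distribution satisfies the inversion formula E[h(Y)] = (1/E[|e(Z)|]) · E[Σ_{k∈e(Z)} h(θ_k Z)] for all measurable h : E₀ → [0,∞) is exceedance-stationary, |Y_0| is Pareto(α)-distributed and independent of Θ := Y/|Y_0|, and Θ satisfies E[g(Θ)] = (1/E[Σ_{k∈ℤ^d}|Q_k|^α]) · E[Σ_{k∈ℤ^d} g(θ_k Q/|Q_k|) |Q_k|^α] for all measurable g : l₀ → [0,∞). -/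

import Mathlib

open MeasureTheory ENNReal Filter ProbabilityTheory

noncomputable section

/-- The space `ℝ^{ℤ^d}` of real-valued fields indexed by `ℤ^d`. -/
abbrev RField (d : ℕ) := (Fin d → ℤ) → ℝ

variable {d : ℕ}

/-- Shift operator: `shift k x = (x_{i+k})_i`, i.e. it moves the origin to `k`. -/
def shift (k : Fin d → ℤ) (x : RField d) : RField d := fun i => x (i + k)

/-- The set of exceedance-points of `x`. -/
def excSet (x : RField d) : Set (Fin d → ℤ) := {k | 1 < |x k|}

open Classical in
/-- Indicator (with values in `ℝ≥0∞`) of the event that `|x k| > s`. -/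
def exIndGT (s : ℝ) (k : Fin d → ℤ) (x : RField d) : ℝ≥0∞ := if s < |x k| then 1 else 0

/-- The tail-process identity:
`E[h(θ_k Y) 1{|Y_k| > 1}] = E[h(Y) 1{|Y_{−k}| > 1}]` for every measurable nonnegative `h`
and every `k ∈ ℤ^d`. -/
def TailIdentity {Ω : Type*} [MeasurableSpace Ω] (μ : Measure Ω) (Y : Ω → RField d) : Prop :=
  ∀ h : RField d → ℝ≥0∞, Measurable h → ∀ k : Fin d → ℤ,
    ∫⁻ ω, h (shift k (Y ω)) * exIndGT 1 k (Y ω) ∂μ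
      = ∫⁻ ω, h (Y ω) * exIndGT 1 (-k) (Y ω) ∂μ

/-- `Y` is exceedance-stationary: for every exceedance-map `τ` which is bijective on a
measurable set `B` (invariant under shifting the origin to exceedance-points, contained in
`ℝ₀^{ℤ^d}`) carrying the law of `Y`, we have `θ_τ Y ≐ Y`. -/
def ExcStationary {Ω : Type*} [MeasurableSpace Ω] (μ : Measure Ω) (Y : Ω → RField d) : Prop :=
  ∀ (B : Set (RField d)) (τ : RField d → Fin d → ℤ),
    MeasurableSet B → Measurable τ →
    (∀ x ∈ B, 1 < |x 0|) →
    (∀ x ∈ B, ∀ k ∈ excSet x, shift k x ∈ B) →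
    (∀ x ∈ B, τ x ∈ excSet x) →
    (∀ x ∈ B, Set.BijOn (fun k => k + τ (shift k x)) (excSet x) (excSet x)) →
    (∀ᵐ ω ∂μ, Y ω ∈ B) →
    Measure.map (fun ω => shift (τ (Y ω)) (Y ω)) μ = Measure.map Y μ

/-- `E₀`: elements of `ℝ₀^{ℤ^d}` with finitely many exceedance-points. -/
def E0set (d : ℕ) : Set (RField d) := {x | 1 < |x 0| ∧ (excSet x).Finite}

/-- `E`: elements of `ℝ^{ℤ^d}` with at least one but finitely many exceedance-points. -/
def Eset (d : ℕ) : Set (RField d) := {x | (excSet x).Nonempty ∧ (excSet x).Finite}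

/-- `l₀`: fields vanishing at infinity. -/
def l0set (d : ℕ) : Set (RField d) := {x | Tendsto (fun i => |x i|) cofinite (nhds 0)}

/-- Uniform norm `‖x‖ = sup_i |x_i|`. -/
def supNorm (x : RField d) : ℝ := ⨆ i, |x i|

/-- `V` is Pareto(α)-distributed: `P(V > y) = y^{-α}` for `y ≥ 1`. -/
def IsPareto {Ω : Type*} [MeasurableSpace Ω] (μ : Measure Ω) (V : Ω → ℝ) (α : ℝ) : Prop :=
  ∀ y : ℝ, 1 ≤ y → μ {ω | y < V ω} = ENNReal.ofReal (y ^ (-α))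

/-- An anchoring function on `S`: a measurable shift-covariant exceedance-map. -/
def IsAnchoringOn (S : Set (RField d)) (A : RField d → Fin d → ℤ) : Prop :=
  Measurable A ∧ ∀ x ∈ S, A x ∈ excSet x ∧ ∀ k ∈ excSet x, A (shift k x) + k = A x

/-- `h` is shift-invariant on `S`. -/
def ShiftInvariantOn (S : Set (RField d)) (h : RField d → ℝ≥0∞) : Prop :=
  ∀ x ∈ S, ∀ k : Fin d → ℤ, h (shift k x) = h x

lemma measurable_shift (k : Fin d → ℤ) : Measurable (shift (d := d) k) :=
  measurable_pi_iff.2 fun i => measurable_pi_apply (i + k)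

lemma shift_shift (k l : Fin d → ℤ) (x : RField d) :
    shift k (shift l x) = shift (k + l) x := by
  funext i
  simp [shift, add_assoc]

lemma mem_excSet_shift {k l : Fin d → ℤ} {x : RField d} :
    k ∈ excSet (shift l x) ↔ k + l ∈ excSet x := Iff.rfl

lemma measurable_exIndGT (s : ℝ) (k : Fin d → ℤ) : Measurable (exIndGT (d := d) s k) := by
  unfold exIndGT
  exact Measurable.ite (measurableSet_lt measurable_const (measurable_pi_apply k).abs)
    measurable_const measurable_const

lemma tsum_exIndGT_mul (x : RField d) (u : (Fin d → ℤ) → ℝ≥0∞) :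
    ∑' k, exIndGT 1 k x * u k = ∑' k : excSet x, u k := by
  rw [tsum_subtype]
  refine tsum_congr fun k => ?_
  by_cases hk : 1 < |x k| <;> simp [exIndGT, Set.indicator, excSet, hk]

lemma tsum_exIndGT (x : RField d) : ∑' k, exIndGT 1 k x = (excSet x).encard := by
  simpa using tsum_exIndGT_mul x (fun _ => 1)

lemma tsum_subtype_comp_bijOn {ι : Type*} {s : Set ι} {φ : ι → ι} (hφ : Set.BijOn φ s s)
    (u : ι → ℝ≥0∞) : ∑' k : s, u (φ k) = ∑' k : s, u k :=
  (Set.BijOn.equiv φ hφ).tsum_eq (fun k : s => u k)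

/-- A bijective exceedance-map induces, from any exceedance-point of `x`, a permutation of the
exceedance-points of `x`. -/
lemma bijOn_excSet_of_shift {τ : RField d → Fin d → ℤ} {x : RField d} {l : Fin d → ℤ}
    (h : Set.BijOn (fun k => k + τ (shift k (shift l x))) (excSet (shift l x))
      (excSet (shift l x))) :
    Set.BijOn (fun k => k + τ (shift k x)) (excSet x) (excSet x) := by
  refine ⟨fun k hk => ?_, fun k hk k' hk' hkk => ?_, fun k hk => ?_⟩
  · have := h.mapsTo (x := k - l) (by simpa [mem_excSet_shift] using hk)
    simp only [shift_shift, mem_excSet_shift, sub_add_cancel] at this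
    rwa [sub_add_eq_add_sub, sub_add_cancel] at this
  · have := h.injOn (x₁ := k - l) (x₂ := k' - l) (by simpa [mem_excSet_shift] using hk)
      (by simpa [mem_excSet_shift] using hk')
    simp only [shift_shift, sub_add_cancel, sub_left_inj] at this
    refine this ?_
    dsimp only at hkk
    rw [sub_add_eq_add_sub, hkk, sub_add_eq_add_sub]
  · obtain ⟨j, hj, hjk⟩ := h.surjOn (a := k - l) (by simpa [mem_excSet_shift] using hk)
    refine ⟨j + l, hj, ?_⟩
    simp only [shift_shift] at hjk ⊢
    rw [add_right_comm, hjk, sub_add_cancel]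

/-- Random elements given by the inversion formula are exceedance-stationary. -/
lemma excStationary_of_inversion {Ω Ω₂ : Type*} [MeasurableSpace Ω] [MeasurableSpace Ω₂]
    {μ : Measure Ω} {μ₂ : Measure Ω₂} {Z : Ω → RField d} (hZ : Measurable Z)
    {Y : Ω₂ → RField d} (hY : Measurable Y) {c : ℝ≥0∞} (hc : c ≠ ⊤)
    (hInv : ∀ h : RField d → ℝ≥0∞, Measurable h →
      ∫⁻ ω, h (Y ω) ∂μ₂
        = c⁻¹ * ∫⁻ ω, ∑' k : Fin d → ℤ, exIndGT 1 k (Z ω) * h (shift k (Z ω)) ∂μ) :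
    ExcStationary μ₂ Y := by
  intro B τ hB hτ _ _ _ hbij hYB
  have hterm (h : RField d → ℝ≥0∞) (hh : Measurable h) : Measurable fun ω =>
      ∑' k : Fin d → ℤ, exIndGT 1 k (Z ω) * h (shift k (Z ω)) :=
    Measurable.tsum fun k => ((measurable_exIndGT 1 k).comp hZ).mul
      (hh.comp ((measurable_shift k).comp hZ))
  have hshiftτ : Measurable fun x : RField d => shift (τ x) x := by
    have hunc : Measurable fun p : RField d × (Fin d → ℤ) => shift p.2 p.1 :=
      measurable_from_prod_countable_left fun k => measurable_shift k
    exact hunc.comp (measurable_id.prodMk hτ)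
  have hZB : ∀ᵐ ω ∂μ, ∀ k ∈ excSet (Z ω), shift k (Z ω) ∈ B := by
    have hind : Measurable (Bᶜ.indicator (1 : RField d → ℝ≥0∞)) :=
      measurable_one.indicator hB.compl
    have h0 := hInv _ hind
    have hY0 : ∫⁻ ω, Bᶜ.indicator (1 : RField d → ℝ≥0∞) (Y ω) ∂μ₂ = 0 := by
      rw [lintegral_eq_zero_iff (hind.fun_comp hY)]
      filter_upwards [hYB] with ω hω
      simp [hω]
    rw [hY0, eq_comm, mul_eq_zero, or_iff_right (ENNReal.inv_ne_zero.2 hc),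
      lintegral_eq_zero_iff (hterm _ hind)] at h0
    filter_upwards [h0] with ω hω k hk
    by_contra hkB
    have := ENNReal.tsum_eq_zero.1 hω k
    rw [exIndGT, if_pos (show 1 < |Z ω k| from hk), Set.indicator_of_mem hkB] at this
    simp at this
  refine Measure.ext_of_lintegral _ fun h hh => ?_
  rw [lintegral_map hh (hshiftτ.fun_comp hY), lintegral_map hh hY, hInv h hh,
    hInv (fun x => h (shift (τ x) x)) (hh.comp hshiftτ)]
  congr 1
  refine lintegral_congr_ae ?_
  filter_upwards [hZB] with ω hω
  rw [tsum_exIndGT_mul, tsum_exIndGT_mul]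
  rcases (excSet (Z ω)).eq_empty_or_nonempty with he | ⟨l, hl⟩
  · simp [he]
  · rw [← tsum_subtype_comp_bijOn (bijOn_excSet_of_shift (hbij _ (hω l hl)))
      fun k => h (shift k (Z ω))]
    refine tsum_congr fun k => ?_
    rw [shift_shift, add_comm]

lemma ae_one_lt_of_pareto {ν : Measure ℝ} [IsProbabilityMeasure ν] {α : ℝ}
    (hν : IsPareto ν id α) : ∀ᵐ v ∂ν, 1 < v := by
  have h1 := hν 1 le_rfl
  rw [Real.one_rpow, ENNReal.ofReal_one] at h1
  exact (prob_compl_eq_zero_iff (measurableSet_lt measurable_const measurable_id)).2 h1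

/-- Conditionally on exceeding `1`, a Pareto variable scaled by `q ∈ (0, 1]` is again Pareto. -/
lemma map_mul_restrict_pareto {ν : Measure ℝ} [IsProbabilityMeasure ν] {α : ℝ}
    (hν : IsPareto ν id α) {q : ℝ} (hq : 0 < q) (hq1 : q ≤ 1) :
    (ν.restrict {v | 1 < v * q}).map (· * q) = ENNReal.ofReal (q ^ α) • ν := by
  have hm : Measurable fun v : ℝ => v * q := measurable_id.mul_const q
  have key (y : ℝ) (hy : 1 ≤ y) :
      ν {v | y < v * q} = ENNReal.ofReal (q ^ α) * ENNReal.ofReal (y ^ (-α)) := by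
    have h1 := hν (y / q) (by rw [le_div_iff₀ hq]; linarith)
    simp only [id, div_lt_iff₀ hq] at h1
    rw [h1, ← ENNReal.ofReal_mul (by positivity), Real.div_rpow (by linarith) hq.le,
      Real.rpow_neg hq.le]
    congr 1
    field_simp
  have hbase : ν {v | 1 < v * q} = ENNReal.ofReal (q ^ α) := by simpa using key 1 le_rfl
  have hone : ∀ᵐ v ∂ν, 1 < v := ae_one_lt_of_pareto hν
  refine ext_of_generate_finite _ (BorelSpace.measurable_eq.trans (borel_eq_generateFrom_Ioi ℝ))
    isPiSystem_Ioi ?_ ?_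
  · rintro _ ⟨y, rfl⟩
    rw [Measure.map_apply hm measurableSet_Ioi, Measure.restrict_apply (hm measurableSet_Ioi),
      Measure.smul_apply, smul_eq_mul]
    rcases le_total 1 y with hy | hy
    · have hset : (fun v : ℝ => v * q) ⁻¹' Set.Ioi y ∩ {v | 1 < v * q} = {v | y < v * q} := by
        ext v
        simp only [Set.mem_inter_iff, Set.mem_preimage, Set.mem_Ioi, Set.mem_ofPred_eq]
        exact ⟨fun h => h.1, fun h => ⟨h, hy.trans_lt h⟩⟩
      rw [hset, key y hy]
      exact congrArg _ (hν y hy).symm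
    · have hset : (fun v : ℝ => v * q) ⁻¹' Set.Ioi y ∩ {v | 1 < v * q} = {v | 1 < v * q} := by
        ext v
        simp only [Set.mem_inter_iff, Set.mem_preimage, Set.mem_Ioi, Set.mem_ofPred_eq]
        exact ⟨fun h => h.2, fun h => ⟨hy.trans_lt h, h⟩⟩
      have hfull : ν (Set.Ioi y) = 1 :=
        (mem_ae_iff_prob_eq_one measurableSet_Ioi).1 (hone.mono fun v hv => hy.trans_lt hv)
      rw [hset, hbase, hfull, mul_one]
  · rw [Measure.map_apply hm MeasurableSet.univ]
    simp [hbase]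

lemma lintegral_exIndGT_smul_pareto {ν : Measure ℝ} [IsProbabilityMeasure ν] {α : ℝ}
    (hν : IsPareto ν id α) {x : RField d} {k : Fin d → ℤ} (hxk : x k ≠ 0) (hx1 : |x k| ≤ 1)
    {h : RField d → ℝ≥0∞} (hh : Measurable h) :
    ∫⁻ v, exIndGT 1 k (v • x) * h (shift k (v • x)) ∂ν
      = ENNReal.ofReal (|x k| ^ α) * ∫⁻ w, h (w • (|x k|⁻¹ • shift k x)) ∂ν := by
  have hq : 0 < |x k| := abs_pos.2 hxk
  have hm : Measurable fun v : ℝ => v * |x k| := measurable_id.mul_const _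
  have hf : Measurable fun w : ℝ => h (w • (|x k|⁻¹ • shift k x)) :=
    hh.comp (measurable_pi_iff.2 fun i => measurable_id.mul_const _)
  rw [← smul_eq_mul (ENNReal.ofReal _), ← lintegral_smul_measure,
    ← map_mul_restrict_pareto hν hq hx1, lintegral_map hf hm,
    ← lintegral_indicator (measurableSet_lt measurable_const hm)]
  refine lintegral_congr_ae ?_
  filter_upwards [ae_one_lt_of_pareto hν] with v hv
  have habs : |(v • x) k| = v * |x k| := by
    rw [Pi.smul_apply, smul_eq_mul, abs_mul, abs_of_pos (by linarith)]
  have hshift : shift k (v • x) = (v * |x k|) • (|x k|⁻¹ • shift k x) := by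
    rw [smul_smul, mul_assoc, mul_inv_cancel₀ hq.ne', mul_one]
    rfl
  by_cases hlt : 1 < v * |x k|
  · rw [exIndGT, habs, if_pos hlt, one_mul, hshift, Set.indicator_of_mem (by exact hlt)]
  · rw [exIndGT, habs, if_neg hlt, zero_mul, Set.indicator_of_notMem (by exact hlt)]

open Classical in
/-- The unnormalized spectral functional `∑_k g(θ_k x / |x_k|) |x_k|^α`. -/
def spectralSum (α : ℝ) (g : RField d → ℝ≥0∞) (x : RField d) : ℝ≥0∞ :=
  ∑' k : Fin d → ℤ, (if x k = 0 then 0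
    else ENNReal.ofReal (|x k| ^ α) * g (|x k|⁻¹ • shift k x))

lemma measurable_spectralSum (α : ℝ) {g : RField d → ℝ≥0∞} (hg : Measurable g) :
    Measurable (spectralSum α g) := by
  refine Measurable.tsum fun k => ?_
  have hk : Measurable fun x : RField d => x k := measurable_pi_apply k
  refine Measurable.ite (hk (measurableSet_singleton 0)) measurable_const
    ((hk.abs.pow_const α).ennreal_ofReal.mul (hg.comp (measurable_pi_iff.2 fun i => ?_)))
  exact hk.abs.inv.mul (measurable_pi_apply (i + k))

lemma spectralSum_one {α : ℝ} (hα : 0 < α) (x : RField d) :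
    spectralSum α (fun _ => 1) x = ∑' k, ENNReal.ofReal (|x k| ^ α) := by
  refine tsum_congr fun k => ?_
  split_ifs with hk
  · simp [hk, Real.zero_rpow hα.ne']
  · rw [mul_one]

lemma spectralSum_congr (α : ℝ) {g g' : RField d → ℝ≥0∞}
    (hgg : ∀ y : RField d, |y 0| = 1 → g y = g' y) (x : RField d) :
    spectralSum α g x = spectralSum α g' x := by
  refine tsum_congr fun k => ?_
  split_ifs with hk
  · rfl
  · rw [hgg]
    simp [shift, abs_mul, hk]

lemma spectralSum_const_mul (α : ℝ) (a : ℝ≥0∞) (g : RField d → ℝ≥0∞) (x : RField d) :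
    spectralSum α (fun y => a * g y) x = a * spectralSum α g x := by
  unfold spectralSum
  rw [← ENNReal.tsum_mul_left]
  refine tsum_congr fun k => ?_
  split_ifs
  · simp
  · exact mul_left_comm _ _ _

lemma abs_le_one_of_supNorm_eq_one {x : RField d} (hx : supNorm x = 1) (k : Fin d → ℤ) :
    |x k| ≤ 1 := by
  have hbdd : BddAbove (Set.range fun i => |x i|) := by
    by_contra hb
    rw [supNorm, Real.iSup_of_not_bddAbove hb] at hx
    exact zero_ne_one hx
  exact hx ▸ le_ciSup hbdd k

lemma measurable_smul_field : Measurable fun p : ℝ × RField d => p.1 • p.2 :=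
  measurable_pi_iff.2 fun i => measurable_fst.mul ((measurable_pi_apply i).comp measurable_snd)

lemma isPareto_map {Ω : Type*} [MeasurableSpace Ω] {μ : Measure Ω} {V : Ω → ℝ} {α : ℝ}
    (hV : Measurable V) (hVp : IsPareto μ V α) : IsPareto (μ.map V) id α := fun y hy =>
  (Measure.map_apply hV (measurableSet_lt measurable_const measurable_id)).trans (hVp y hy)

/-- Sums over the exceedance-points of `V • Q` in terms of `Q` and the law of `V`. -/
lemma lintegral_tsum_exIndGT_smul {Ω : Type*} [MeasurableSpace Ω] {μ : Measure Ω}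
    [IsProbabilityMeasure μ] {α : ℝ} {Q : Ω → RField d} (hQ : Measurable Q)
    (hQ1 : ∀ᵐ ω ∂μ, ∀ k, |Q ω k| ≤ 1) {V : Ω → ℝ} (hV : Measurable V)
    (hVp : IsPareto μ V α) (hind : IndepFun V Q μ) {h : RField d → ℝ≥0∞} (hh : Measurable h) :
    ∫⁻ ω, ∑' k : Fin d → ℤ, exIndGT 1 k (V ω • Q ω) * h (shift k (V ω • Q ω)) ∂μ
      = ∫⁻ ω, spectralSum α (fun y => ∫⁻ w, h (w • y) ∂(μ.map V)) (Q ω) ∂μ := by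
  have : IsProbabilityMeasure (μ.map V) := Measure.isProbabilityMeasure_map hV.aemeasurable
  have : IsProbabilityMeasure (μ.map Q) := Measure.isProbabilityMeasure_map hQ.aemeasurable
  have hν := isPareto_map hV hVp
  let F : ℝ × RField d → ℝ≥0∞ := fun p =>
    ∑' k : Fin d → ℤ, exIndGT 1 k (p.1 • p.2) * h (shift k (p.1 • p.2))
  have hterm (k : Fin d → ℤ) : Measurable fun p : ℝ × RField d =>
      exIndGT 1 k (p.1 • p.2) * h (shift k (p.1 • p.2)) :=
    ((measurable_exIndGT 1 k).comp measurable_smul_field).mul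
      (hh.comp ((measurable_shift k).comp measurable_smul_field))
  have hF : Measurable F := Measurable.tsum hterm
  have hinner : Measurable fun x : RField d => ∫⁻ v, F (v, x) ∂(μ.map V) :=
    hF.lintegral_prod_left'
  calc ∫⁻ ω, F (V ω, Q ω) ∂μ
      = ∫⁻ p, F p ∂((μ.map V).prod (μ.map Q)) := by
        rw [← (indepFun_iff_map_prod_eq_prod_map_map hV.aemeasurable hQ.aemeasurable).1 hind,
          lintegral_map hF (hV.prodMk hQ)]
    _ = ∫⁻ ω, ∫⁻ v, F (v, Q ω) ∂(μ.map V) ∂μ := by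
        rw [lintegral_prod_symm' _ hF, lintegral_map hinner hQ]
    _ = _ := by
        refine lintegral_congr_ae ?_
        filter_upwards [hQ1] with ω hω
        dsimp only [F]
        refine (lintegral_tsum fun k =>
          ((hterm k).comp (measurable_prodMk_right (y := Q ω))).aemeasurable).trans
            (tsum_congr fun k => ?_)
        dsimp only [Function.comp_apply]
        split_ifs with hk
        · simp [exIndGT, hk, zero_le_one.not_gt]
        · exact lintegral_exIndGT_smul_pareto hν hk (hω k) hh

lemma measurable_normalize :
    Measurable fun x : RField d => (fun i => x i / |x 0| : RField d) :=
  measurable_pi_iff.2 fun i => (measurable_pi_apply i).div (measurable_pi_apply 0).abs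

/-- Under a Pareto radius the polar decomposition at the origin factorizes. -/
lemma lintegral_polar_smul {ν : Measure ℝ} [IsProbabilityMeasure ν] {α : ℝ}
    (hν : IsPareto ν id α) {f : ℝ → ℝ≥0∞} (hf : Measurable f) (g : RField d → ℝ≥0∞)
    {y : RField d} (hy : |y 0| = 1) :
    ∫⁻ w, f |(w • y) 0| * g (fun i => (w • y) i / |(w • y) 0|) ∂ν = (∫⁻ w, f w ∂ν) * g y := by
  rw [← lintegral_mul_const _ hf]
  refine lintegral_congr_ae ?_
  filter_upwards [ae_one_lt_of_pareto hν] with w hw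
  have habs : |(w • y) 0| = w := by
    rw [Pi.smul_apply, smul_eq_mul, abs_mul, hy, mul_one, abs_of_pos (by linarith)]
  have hdir : (fun i => (w • y) i / w) = y := by
    funext i
    rw [Pi.smul_apply, smul_eq_mul, mul_div_cancel_left₀ _ (by linarith)]
  rw [habs, hdir]

open Classical in
/-- Let `Q ∈ l₀` with `‖Q‖ = 1` a.s. and `E[Σ_k |Q_k|^α] < ∞`, let `V` be
Pareto(α)-distributed and independent of `Q`, and set `Z := V·Q`. Then
`E[|e(Z)|] = E[Σ_k |Q_k|^α] < ∞`, and any random element `Y` of `E₀` whose distribution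
satisfies the inversion formula generated by `Z` is exceedance-stationary, with `|Y_0|`
Pareto(α)-distributed and independent of `Θ := Y/|Y_0|`, and `Θ` satisfies the spectral
inversion formula generated by `Q`. -/
theorem generated_exceedance_stationary_is_tail_process
    {Ω : Type*} [MeasurableSpace Ω] (μ : Measure Ω) [IsProbabilityMeasure μ]
    {Ω₂ : Type*} [MeasurableSpace Ω₂] (μ₂ : Measure Ω₂) [IsProbabilityMeasure μ₂]
    (α : ℝ) (hα : 0 < α)
    (Q : Ω → RField d) (hQ : Measurable Q) (hQl0 : ∀ᵐ ω ∂μ, Q ω ∈ l0set d)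
    (hQnorm : ∀ᵐ ω ∂μ, supNorm (Q ω) = 1)
    (hQfin : ∫⁻ ω, ∑' k : Fin d → ℤ, ENNReal.ofReal (|Q ω k| ^ α) ∂μ ≠ ⊤)
    (V : Ω → ℝ) (hV : Measurable V) (hVp : IsPareto μ V α) (hind : IndepFun V Q μ)
    (Z : Ω → RField d) (hZdef : Z = fun ω => V ω • Q ω)
    (Y : Ω₂ → RField d) (hY : Measurable Y) (hE0 : ∀ᵐ ω ∂μ₂, Y ω ∈ E0set d)
    (hInv : ∀ h : RField d → ℝ≥0∞, Measurable h →
      ∫⁻ ω, h (Y ω) ∂μ₂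
        = (∫⁻ ω, (excSet (Z ω)).encard ∂μ)⁻¹ *
            ∫⁻ ω, ∑' k : Fin d → ℤ, exIndGT 1 k (Z ω) * h (shift k (Z ω)) ∂μ) :
    (∫⁻ ω, (excSet (Z ω)).encard ∂μ
        = ∫⁻ ω, ∑' k : Fin d → ℤ, ENNReal.ofReal (|Q ω k| ^ α) ∂μ) ∧
    (∫⁻ ω, (excSet (Z ω)).encard ∂μ ≠ ⊤) ∧
    ExcStationary μ₂ Y ∧
    IsPareto μ₂ (fun ω => |Y ω 0|) α ∧
    IndepFun (fun ω => |Y ω 0|) (fun ω => fun i => Y ω i / |Y ω 0|) μ₂ ∧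
    (∀ g : RField d → ℝ≥0∞, Measurable g →
      ∫⁻ ω, g (fun i => Y ω i / |Y ω 0|) ∂μ₂
        = (∫⁻ ω, ∑' k : Fin d → ℤ, ENNReal.ofReal (|Q ω k| ^ α) ∂μ)⁻¹ *
            ∫⁻ ω, ∑' k : Fin d → ℤ,
              (if Q ω k = 0 then 0
                else ENNReal.ofReal (|Q ω k| ^ α) * g (|Q ω k|⁻¹ • shift k (Q ω))) ∂μ) := by
  subst hZdef
  have hQ1 : ∀ᵐ ω ∂μ, ∀ k, |Q ω k| ≤ 1 :=
    hQnorm.mono fun ω hω => abs_le_one_of_supNorm_eq_one hω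
  have : IsProbabilityMeasure (μ.map V) := Measure.isProbabilityMeasure_map hV.aemeasurable
  have hν := isPareto_map hV hVp
  have hcount : ∫⁻ ω, (excSet (V ω • Q ω)).encard ∂μ
      = ∫⁻ ω, ∑' k : Fin d → ℤ, ENNReal.ofReal (|Q ω k| ^ α) ∂μ := by
    have h1 := lintegral_tsum_exIndGT_smul hQ hQ1 hV hVp hind
      (measurable_const (a := (1 : ℝ≥0∞)))
    simpa only [mul_one, tsum_exIndGT, lintegral_const, measure_univ, spectralSum_one hα]
      using h1
  have hfin := hcount ▸ hQfin
  have hZ : Measurable fun ω => V ω • Q ω := measurable_smul_field.comp (hV.prodMk hQ)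
  have hpolar (f : ℝ → ℝ≥0∞) (hf : Measurable f) (g : RField d → ℝ≥0∞) (hg : Measurable g) :
      ∫⁻ ω, f |Y ω 0| * g (fun i => Y ω i / |Y ω 0|) ∂μ₂
        = (∫⁻ w, f w ∂(μ.map V)) *
          ((∫⁻ ω, ∑' k : Fin d → ℤ, ENNReal.ofReal (|Q ω k| ^ α) ∂μ)⁻¹ *
            ∫⁻ ω, spectralSum α g (Q ω) ∂μ) := by
    have hh : Measurable fun x : RField d => f |x 0| * g (fun i => x i / |x 0|) :=
      (hf.comp (measurable_pi_apply 0).abs).mul (hg.comp measurable_normalize)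
    rw [hInv _ hh, hcount, lintegral_tsum_exIndGT_smul hQ hQ1 hV hVp hind hh]
    simp only [spectralSum_congr α fun y hy => lintegral_polar_smul hν hf g hy,
      spectralSum_const_mul]
    rw [lintegral_const_mul _ ((measurable_spectralSum α hg).fun_comp hQ), mul_left_comm]
  have hone : (∫⁻ ω, ∑' k : Fin d → ℤ, ENNReal.ofReal (|Q ω k| ^ α) ∂μ)⁻¹ *
      ∫⁻ ω, spectralSum α (fun _ => 1) (Q ω) ∂μ = 1 := by
    simpa using (hpolar (fun _ => 1) measurable_const (fun _ => 1) measurable_const).symm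
  have hspec (g : RField d → ℝ≥0∞) (hg : Measurable g) :
      ∫⁻ ω, g (fun i => Y ω i / |Y ω 0|) ∂μ₂
        = (∫⁻ ω, ∑' k : Fin d → ℤ, ENNReal.ofReal (|Q ω k| ^ α) ∂μ)⁻¹ *
            ∫⁻ ω, spectralSum α g (Q ω) ∂μ := by
    simpa using hpolar (fun _ => 1) measurable_const g hg
  have hradial (f : ℝ → ℝ≥0∞) (hf : Measurable f) :
      ∫⁻ ω, f |Y ω 0| ∂μ₂ = ∫⁻ w, f w ∂(μ.map V) := by
    simpa [hone] using hpolar f hf (fun _ => 1) measurable_const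
  have hR : Measurable fun ω => |Y ω 0| := ((measurable_pi_apply 0).comp hY).abs
  have hΘ : Measurable fun ω => (fun i => Y ω i / |Y ω 0| : RField d) :=
    measurable_normalize.comp hY
  have hlaw : μ₂.map (fun ω => |Y ω 0|) = μ.map V :=
    Measure.ext_of_lintegral _ fun f hf => by rw [lintegral_map hf hR, hradial f hf]
  refine ⟨hcount, hfin, excStationary_of_inversion hZ hY hfin hInv, fun y hy => ?_, ?_, hspec⟩
  · have hm : MeasurableSet (Set.Ioi y) := measurableSet_Ioi
    exact (Measure.map_apply hR hm).symm.trans (hlaw ▸ hν y hy)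
  · rw [indepFun_iff_measure_inter_preimage_eq_mul]
    intro s t hs ht
    have hs' : Measurable (s.indicator (1 : ℝ → ℝ≥0∞)) := measurable_one.indicator hs
    have ht' : Measurable (t.indicator (1 : RField d → ℝ≥0∞)) := measurable_one.indicator ht
    have hp := hpolar _ hs' _ ht'
    rw [← hspec _ ht', ← hradial _ hs'] at hp
    rw [← lintegral_indicator_one ((hR hs).inter (hΘ ht)), ← lintegral_indicator_one (hR hs),
      ← lintegral_indicator_one (hΘ ht), Set.inter_indicator_one]
    exact hp
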